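/- Tripartite monogamy with two shared qubits: For every 4-qubit density matrix ρ, the xy-plane Bell strengths of the triples (1,2,3) and (1,2,4) satisfy 𝒯²₁₂₃(ρ) + 𝒯²₁₂₄(ρ) ≤ 4. -/

import Mathlib

open Matrix Complex ComplexOrder

noncomputable section

/-- The Pauli X matrix. -/
def pX : Matrix (Fin 2) (Fin 2) ℂ := !![0, 1; 1, 0]

/-- The Pauli Y matrix. -/
def pY : Matrix (Fin 2) (Fin 2) ℂ := !![0, -Complex.I; Complex.I, 0]

/-- The Pauli Z matrix. -/
def pZ : Matrix (Fin 2) (Fin 2) ℂ := !![1, 0; 0, -1]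

/-- The operator on `n` qubits acting as the single-qubit operator `M` on qubit `i`
and as the identity on all other qubits. -/
def onQubit {n : ℕ} (M : Matrix (Fin 2) (Fin 2) ℂ) (i : Fin n) :
    Matrix (Fin n → Fin 2) (Fin n → Fin 2) ℂ :=
  Matrix.of fun a b => ∏ s, if s = i then M (a s) (b s) else (if a s = b s then 1 else 0)

/-- An `n`-qubit density matrix: positive semidefinite with unit trace. -/
def IsDensityMatrix {n : ℕ} (ρ : Matrix (Fin n → Fin 2) (Fin n → Fin 2) ℂ) : Prop :=
  ρ.PosSemidef ∧ ρ.trace = 1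

/-- The two Pauli matrices spanning the xy plane. -/
def XY : Fin 2 → Matrix (Fin 2) (Fin 2) ℂ := ![pX, pY]

/-- The two Pauli matrices spanning the xz plane. -/
def XZ : Fin 2 → Matrix (Fin 2) (Fin 2) ℂ := ![pX, pZ]

/-- The xy-plane Bell strength 𝒯²_{ij}(ρ) of the pair of qubits (i,j). -/
def T2pair {n : ℕ} (ρ : Matrix (Fin n → Fin 2) (Fin n → Fin 2) ℂ) (i j : Fin n) : ℝ :=
  ∑ k : Fin 2, ∑ l : Fin 2,
    ((ρ * (onQubit (XY k) i * onQubit (XY l) j)).trace.re) ^ 2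

/-- The xy-plane Bell strength 𝒯²_{ijm}(ρ) of the triple of qubits (i,j,m). -/
def T2triple {n : ℕ} (ρ : Matrix (Fin n → Fin 2) (Fin n → Fin 2) ℂ) (i j m : Fin n) : ℝ :=
  ∑ k : Fin 2, ∑ l : Fin 2, ∑ p : Fin 2,
    ((ρ * (onQubit (XY k) i * onQubit (XY l) j * onQubit (XY p) m)).trace.re) ^ 2

/-- The xy-plane Bell strength 𝒯²_{ijml}(ρ) of the quadruple of qubits (i,j,m,l). -/
def T2quad {n : ℕ} (ρ : Matrix (Fin n → Fin 2) (Fin n → Fin 2) ℂ) (i j m l : Fin n) : ℝ :=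
  ∑ k : Fin 2, ∑ k' : Fin 2, ∑ k'' : Fin 2, ∑ k''' : Fin 2,
    ((ρ * (onQubit (XY k) i * onQubit (XY k') j * onQubit (XY k'') m *
        onQubit (XY k''') l)).trace.re) ^ 2

/-- The xz-plane Bell strength of the pair of qubits (i,j). -/
def T2pairXZ {n : ℕ} (ρ : Matrix (Fin n → Fin 2) (Fin n → Fin 2) ℂ) (i j : Fin n) : ℝ :=
  ∑ k : Fin 2, ∑ l : Fin 2,
    ((ρ * (onQubit (XZ k) i * onQubit (XZ l) j)).trace.re) ^ 2

/-- The tensor product of a family of single-qubit operators. -/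
def tensorOp {n : ℕ} (F : Fin n → Matrix (Fin 2) (Fin 2) ℂ) :
    Matrix (Fin n → Fin 2) (Fin n → Fin 2) ℂ :=
  Matrix.of fun a b => ∏ s, F s (a s) (b s)

theorem tensorOp_mul {n : ℕ} (F G : Fin n → Matrix (Fin 2) (Fin 2) ℂ) :
    tensorOp F * tensorOp G = tensorOp (F * G) := by
  ext a b
  simp only [tensorOp, Matrix.mul_apply, Matrix.of_apply, Pi.mul_apply, Finset.prod_univ_sum,
    Fintype.piFinset_univ, Finset.prod_mul_distrib]

theorem onQubit_eq_tensorOp {n : ℕ} (M : Matrix (Fin 2) (Fin 2) ℂ) (i : Fin n) :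
    onQubit M i = tensorOp (Pi.mulSingle i M) := by
  ext a b
  simp only [onQubit, tensorOp, Matrix.of_apply]
  refine Finset.prod_congr rfl fun s _ => ?_
  by_cases h : s = i
  · subst h
    simp
  · simp [h, Matrix.one_apply]

theorem onQubit_mul {n : ℕ} (M N : Matrix (Fin 2) (Fin 2) ℂ) (i : Fin n) :
    onQubit M i * onQubit N i = onQubit (M * N) i := by
  simp only [onQubit_eq_tensorOp, tensorOp_mul, Pi.mulSingle_mul]

theorem onQubit_commute {n : ℕ} (M N : Matrix (Fin 2) (Fin 2) ℂ) {i j : Fin n} (h : i ≠ j) :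
    Commute (onQubit M i) (onQubit N j) := by
  rw [Commute, SemiconjBy]
  simp only [onQubit_eq_tensorOp, tensorOp_mul]
  exact congrArg tensorOp
    (Pi.mulSingle_commute (f := fun _ => Matrix (Fin 2) (Fin 2) ℂ) h M N).eq

theorem onQubit_one {n : ℕ} (i : Fin n) : onQubit 1 i = 1 := by
  ext a b
  simp [onQubit, Matrix.one_apply, Finset.prod_ite_zero, funext_iff]

theorem onQubit_neg {n : ℕ} (M : Matrix (Fin 2) (Fin 2) ℂ) (i : Fin n) :
    onQubit (-M) i = -onQubit M i := by
  ext a b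
  simp only [onQubit, Matrix.of_apply, Matrix.neg_apply]
  rw [← Finset.mul_prod_erase _ _ (Finset.mem_univ i),
    ← Finset.mul_prod_erase Finset.univ
      (fun s => if s = i then M (a s) (b s) else (if a s = b s then 1 else 0)) (Finset.mem_univ i)]
  simp only [if_true, neg_mul]
  congr 2
  exact Finset.prod_congr rfl fun s hs => by simp [Finset.ne_of_mem_erase hs]

theorem onQubit_isHermitian {n : ℕ} {M : Matrix (Fin 2) (Fin 2) ℂ} (hM : M.IsHermitian)
    (i : Fin n) : (onQubit M i).IsHermitian := by
  ext a b
  simp only [onQubit, Matrix.conjTranspose_apply, Matrix.of_apply, star_prod]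
  refine Finset.prod_congr rfl fun s _ => ?_
  split_ifs <;> simp_all [hM.apply]

theorem XY_isHermitian (k : Fin 2) : (XY k).IsHermitian := by
  ext a b
  fin_cases k <;> fin_cases a <;> fin_cases b <;> simp [XY, pX, pY]

theorem XY_mul_self (k : Fin 2) : XY k * XY k = 1 := by
  ext a b
  fin_cases k <;> fin_cases a <;> fin_cases b <;> simp [XY, pX, pY, Matrix.mul_apply]

theorem XY_mul_of_ne {k l : Fin 2} (h : k ≠ l) : XY k * XY l = -(XY l * XY k) := by
  ext a b
  fin_cases k <;> fin_cases l <;> fin_cases a <;> fin_cases b <;>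
    simp [XY, pX, pY, Matrix.mul_apply] at h ⊢

theorem onQubit_XY_mul_self {n : ℕ} (k : Fin 2) (i : Fin n) :
    onQubit (XY k) i * onQubit (XY k) i = 1 := by
  rw [onQubit_mul, XY_mul_self, onQubit_one]

theorem onQubit_XY_mul_of_ne {n : ℕ} {k l : Fin 2} (h : k ≠ l) (i : Fin n) :
    onQubit (XY k) i * onQubit (XY l) i = -(onQubit (XY l) i * onQubit (XY k) i) := by
  rw [onQubit_mul, onQubit_mul, XY_mul_of_ne h, onQubit_neg]

theorem onQubit_triple_isHermitian {n : ℕ} (k l p : Fin 2) {i j m : Fin n}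
    (hij : i ≠ j) (him : i ≠ m) (hjm : j ≠ m) :
    (onQubit (XY k) i * onQubit (XY l) j * onQubit (XY p) m).IsHermitian := by
  have hi := onQubit_isHermitian (XY_isHermitian k) i
  have hj := onQubit_isHermitian (XY_isHermitian l) j
  have hm := onQubit_isHermitian (XY_isHermitian p) m
  rw [Matrix.IsHermitian, Matrix.conjTranspose_mul, Matrix.conjTranspose_mul, hi.eq, hj.eq, hm.eq,
    ← (onQubit_commute (XY k) (XY l) hij).eq]
  exact (((onQubit_commute _ _ him).mul_left (onQubit_commute _ _ hjm)).eq).symm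

theorem onQubit_triple_mul {n : ℕ} (k l l' p p' : Fin 2) {i j m m' : Fin n}
    (hij : i ≠ j) (him : i ≠ m) (hjm : j ≠ m) :
    (onQubit (XY k) i * onQubit (XY l) j * onQubit (XY p) m) *
        (onQubit (XY k) i * onQubit (XY l') j * onQubit (XY p') m') =
      (onQubit (XY l) j * onQubit (XY l') j) * (onQubit (XY p) m * onQubit (XY p') m') := by
  have hm : Commute (onQubit (XY p) m) (onQubit (XY k) i * onQubit (XY l') j) :=
    (onQubit_commute _ _ him.symm).mul_right (onQubit_commute _ _ hjm.symm)
  have hi : Commute (onQubit (XY l) j) (onQubit (XY k) i) := onQubit_commute _ _ hij.symm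
  calc
    _ = onQubit (XY k) i * onQubit (XY l) j *
          (onQubit (XY p) m * (onQubit (XY k) i * onQubit (XY l') j)) * onQubit (XY p') m' := by
      simp only [mul_assoc]
    _ = onQubit (XY k) i * (onQubit (XY l) j * onQubit (XY k) i) * onQubit (XY l') j *
          (onQubit (XY p) m * onQubit (XY p') m') := by
      rw [hm.eq]; simp only [mul_assoc]
    _ = onQubit (XY k) i * onQubit (XY k) i * (onQubit (XY l) j * onQubit (XY l') j) *
          (onQubit (XY p) m * onQubit (XY p') m') := by
      rw [hi.eq]; simp only [mul_assoc]
    _ = _ := by rw [onQubit_XY_mul_self, one_mul]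

/-- The square of a real combination of pairwise anticommuting involutions is scalar. -/
theorem sum_smul_mul_self_of_anticommute {ι R : Type*} [Fintype ι] [Ring R] [Algebra ℝ R]
    (A : ι → R) (hsq : ∀ i, A i * A i = 1) (hanti : ∀ i j, i ≠ j → A i * A j = -(A j * A i))
    (t : ι → ℝ) :
    (∑ i, t i • A i) * (∑ i, t i • A i) = (∑ i, t i ^ 2) • (1 : R) := by
  classical
  have key : (2 : ℝ) • ((∑ i, t i • A i) * (∑ i, t i • A i)) =
      (2 : ℝ) • ((∑ i, t i ^ 2) • (1 : R)) := by
    have hexp : (∑ i, t i • A i) * (∑ i, t i • A i) =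
        ∑ i, ∑ j, (t i * t j) • (A i * A j) := by
      simp only [Finset.sum_mul_sum, smul_mul_smul_comm]
    have hcomm : (∑ i, t i • A i) * (∑ i, t i • A i) =
        ∑ i, ∑ j, (t j * t i) • (A j * A i) := hexp.trans Finset.sum_comm
    rw [two_smul]
    nth_rewrite 1 [hexp]
    rw [hcomm, ← Finset.sum_add_distrib, Finset.sum_smul, Finset.smul_sum]
    refine Finset.sum_congr rfl fun i _ => ?_
    rw [← Finset.sum_add_distrib, Finset.sum_eq_single i]
    · rw [hsq, two_smul, pow_two]
    · intro j _ hj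
      rw [hanti j i hj, mul_comm (t j), smul_neg, add_neg_cancel]
    · simp
  exact smul_right_injective R (two_ne_zero (α := ℝ)) key

/-- The squared expectation values of pairwise anticommuting Hermitian involutions sum to at most
one in every state. -/
theorem sum_sq_trace_le_one_of_anticommute {ι m : Type*} [Fintype ι] [Fintype m] [DecidableEq m]
    {ρ : Matrix m m ℂ} (hρ : ρ.PosSemidef) (htr : ρ.trace = 1)
    (A : ι → Matrix m m ℂ) (hA : ∀ i, (A i).IsHermitian) (hsq : ∀ i, A i * A i = 1)
    (hanti : ∀ i j, i ≠ j → A i * A j = -(A j * A i)) :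
    ∑ i, ((ρ * A i).trace.re) ^ 2 ≤ 1 := by
  set t : ι → ℝ := fun i => (ρ * A i).trace.re with ht
  set c : ℝ := ∑ i, t i ^ 2 with hc
  set S : Matrix m m ℂ := ∑ i, t i • A i with hS
  have hSS : S * S = c • (1 : Matrix m m ℂ) := sum_smul_mul_self_of_anticommute A hsq hanti t
  have hSh : Sᴴ = S := by
    simp [hS, Matrix.conjTranspose_sum, Matrix.conjTranspose_smul, (hA _).eq]
  have hSt : (ρ * S).trace.re = c := by
    simp [hS, hc, Matrix.mul_sum, Matrix.trace_sum, Matrix.trace_smul, pow_two, ht]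
  have hpos := (hρ.mul_mul_conjTranspose_same (S - c • (1 : Matrix m m ℂ))).trace_nonneg
  have hH : (S - c • (1 : Matrix m m ℂ))ᴴ = S - c • (1 : Matrix m m ℂ) := by
    simp [Matrix.conjTranspose_sub, Matrix.conjTranspose_smul, hSh]
  have hsquare : (S - c • (1 : Matrix m m ℂ)) * (S - c • (1 : Matrix m m ℂ)) =
      (c + c ^ 2) • (1 : Matrix m m ℂ) - (2 * c) • S := by
    rw [sub_mul, mul_sub, mul_sub, hSS]
    simp only [mul_smul_comm, smul_mul_assoc, mul_one, one_mul]
    module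
  rw [hH, mul_assoc, Matrix.trace_mul_comm, mul_assoc, hsquare] at hpos
  have hre := (Complex.le_def.1 hpos).1
  simp only [mul_sub, mul_smul_comm, mul_one, Matrix.trace_sub, Matrix.trace_smul, htr,
    Complex.sub_re, Complex.real_smul, Complex.re_ofReal_mul, Complex.ofReal_re, hSt,
    Complex.zero_re] at hre
  nlinarith

/-- Fixing the operator on qubit 1 and pairing different operators on qubit 2 with qubits 3 and 4
gives four pairwise anticommuting observables. -/
theorem sum_sq_trace_onQubit_le_one {ρ : Matrix (Fin 4 → Fin 2) (Fin 4 → Fin 2) ℂ}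
    (hρ : IsDensityMatrix ρ) (k : Fin 2) {l l' : Fin 2} (hl : l ≠ l') :
    ∑ p, ((ρ * (onQubit (XY k) 0 * onQubit (XY l) 1 * onQubit (XY p) 2)).trace.re) ^ 2 +
      ∑ p, ((ρ * (onQubit (XY k) 0 * onQubit (XY l') 1 * onQubit (XY p) 3)).trace.re) ^ 2 ≤ 1 := by
  let A : Fin 2 ⊕ Fin 2 → Matrix (Fin 4 → Fin 2) (Fin 4 → Fin 2) ℂ :=
    Sum.elim (fun p => onQubit (XY k) 0 * onQubit (XY l) 1 * onQubit (XY p) 2)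
      (fun p => onQubit (XY k) 0 * onQubit (XY l') 1 * onQubit (XY p) 3)
  have h := sum_sq_trace_le_one_of_anticommute hρ.1 hρ.2 A ?_ ?_ ?_
  · simpa only [A, Fintype.sum_sum_type, Sum.elim_inl, Sum.elim_inr] using h
  · rintro (p | p) <;>
      exact onQubit_triple_isHermitian _ _ _ (by decide) (by decide) (by decide)
  · rintro (p | p) <;> simp only [A, Sum.elim_inl, Sum.elim_inr] <;>
      rw [onQubit_triple_mul _ _ _ _ _ (by decide) (by decide) (by decide), onQubit_XY_mul_self,
        onQubit_XY_mul_self, one_mul]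
  · rintro (p | p) (q | q) hpq <;> simp only [A, Sum.elim_inl, Sum.elim_inr] <;>
      rw [onQubit_triple_mul _ _ _ _ _ (by decide) (by decide) (by decide),
        onQubit_triple_mul _ _ _ _ _ (by decide) (by decide) (by decide)]
    · rw [onQubit_XY_mul_of_ne (k := p) (l := q) (fun h => hpq (congrArg _ h)),
        onQubit_XY_mul_self, mul_neg]
    · rw [onQubit_XY_mul_of_ne hl, (onQubit_commute (XY p) (XY q) (by decide)).eq, neg_mul]
    · rw [onQubit_XY_mul_of_ne hl.symm, (onQubit_commute (XY p) (XY q) (by decide)).eq, neg_mul]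
    · rw [onQubit_XY_mul_of_ne (k := p) (l := q) (fun h => hpq (congrArg _ h)),
        onQubit_XY_mul_self, mul_neg]

/-- **Tripartite monogamy with two shared qubits.** For every 4-qubit density matrix,
𝒯²₁₂₃(ρ) + 𝒯²₁₂₄(ρ) ≤ 4. -/
theorem tripartite_monogamy_two_shared (ρ : Matrix (Fin 4 → Fin 2) (Fin 4 → Fin 2) ℂ)
    (hρ : IsDensityMatrix ρ) :
    T2triple ρ 0 1 2 + T2triple ρ 0 1 3 ≤ 4 := by
  have h01 := fun k => sum_sq_trace_onQubit_le_one hρ k (l := 0) (l' := 1) (by decide)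
  have h10 := fun k => sum_sq_trace_onQubit_le_one hρ k (l := 1) (l' := 0) (by decide)
  simp only [T2triple, Fin.sum_univ_two] at h01 h10 ⊢
  linarith [h01 0, h01 1, h10 0, h10 1]
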